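/- Let n be a positive integer and let A, B be real numbers with (B)_n ≠ 0. Then ∑_{k=0}^{⌊n/2⌋} [ (−n/2)_k · ((1−n)/2)_k · (−A)_k · (A+B)_k ] / [ k! · (1−n)_k · (B/2)_k · ((1+B)/2)_k ] = (A+B)_n / (B)_n + (−A)_n / (B)_n. (Lemma A3, a terminating 4F3 summation) -/

import Mathlib

open Finset

/-- The Pochhammer symbol `(a)_k = a(a+1)⋯(a+k-1)` for a real `a`. -/
noncomputable def poch (a : ℝ) (k : ℕ) : ℝ := ∏ i ∈ Finset.range k, (a + i)

lemma poch_zero (a : ℝ) : poch a 0 = 1 := by simp [poch]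

lemma poch_succ (a : ℝ) (k : ℕ) : poch a (k + 1) = poch a k * (a + k) := by
  simp [poch, Finset.prod_range_succ]

lemma poch_succ' (a : ℝ) (k : ℕ) : poch a (k + 1) = a * poch (a + 1) k := by
  induction k with
  | zero => simp [poch]
  | succ k ih => rw [poch_succ, ih, poch_succ]; push_cast; ring

lemma poch_add (a : ℝ) (j k : ℕ) : poch a (j + k) = poch a j * poch (a + j) k := by
  induction k with
  | zero => simp [poch]
  | succ k ih => rw [← add_assoc, poch_succ, ih, poch_succ]; push_cast; ring

/-- The duplication formula. -/
lemma poch_two_mul (a : ℝ) (k : ℕ) :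
    poch a (2 * k) = 4 ^ k * (poch (a / 2) k * poch ((1 + a) / 2) k) := by
  induction k with
  | zero => simp [poch]
  | succ k ih =>
    rw [show 2 * (k + 1) = 2 * k + 1 + 1 by ring, poch_succ, poch_succ, ih, poch_succ, poch_succ]
    push_cast
    ring

lemma poch_neg_mul_factorial (m j : ℕ) :
    poch (-((m : ℝ) + j)) j * (m.factorial : ℝ) = (-1) ^ j * ((m + j).factorial : ℝ) := by
  induction j with
  | zero => simp [poch]
  | succ j ih =>
    rw [poch_succ', show -((m : ℝ) + (j + 1 : ℕ)) + 1 = -((m : ℝ) + j) by push_cast; ring,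
      mul_assoc, ih, ← add_assoc, Nat.factorial_succ]
    push_cast
    ring

/-- The coefficients of the Lucas polynomials: `lucasCoeff n k = n / (n - k) * (n - k).choose k`
for `0 < n` and `2 * k ≤ n`. -/
def lucasCoeff : ℕ → ℕ → ℕ
  | 0, 0 => 2
  | 0, _ + 1 => 0
  | 1, 0 => 1
  | 1, _ + 1 => 0
  | _ + 2, 0 => 1
  | n + 2, k + 1 => lucasCoeff (n + 1) (k + 1) + lucasCoeff n k

lemma lucasCoeff_succ_zero (n : ℕ) : lucasCoeff (n + 1) 0 = 1 := by
  cases n <;> simp [lucasCoeff]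

lemma lucasCoeff_eq_zero : ∀ {n k : ℕ}, n < 2 * k → lucasCoeff n k = 0
  | _, 0, h => by omega
  | 0, _ + 1, _ => by simp [lucasCoeff]
  | 1, _ + 1, _ => by simp [lucasCoeff]
  | n + 2, k + 1, h => by
    rw [lucasCoeff, lucasCoeff_eq_zero (n := n + 1) (k := k + 1) (by omega),
      lucasCoeff_eq_zero (n := n) (k := k) (by omega)]

lemma lucasCoeff_mul_factorial (s : ℕ) : ∀ m k : ℕ, m + k = s + 1 →
    lucasCoeff (m + 2 * k) k * (k.factorial * m.factorial) = (m + 2 * k) * s.factorial := by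
  induction s with
  | zero =>
    intro m k h
    obtain ⟨rfl, rfl⟩ | ⟨rfl, rfl⟩ : m = 0 ∧ k = 1 ∨ m = 1 ∧ k = 0 := by omega
    all_goals simp [lucasCoeff]
  | succ s ih =>
    intro m k h
    match m, k with
    | m, 0 =>
      obtain rfl : m = s + 2 := by omega
      simp [lucasCoeff, Nat.factorial_succ (s + 1)]
    | 0, k + 1 =>
      obtain rfl : k = s + 1 := by omega
      have h0 := ih 0 (s + 1) (by omega)
      rw [show 0 + 2 * (s + 1 + 1) = 2 * (s + 1) + 2 by ring, lucasCoeff,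
        lucasCoeff_eq_zero (by omega)]
      rw [zero_add] at h0
      rw [Nat.factorial_succ (s + 1)]
      linear_combination (s + 2) * h0 + (2 * s + 4) * (Nat.factorial_succ s).symm
    | m + 1, k + 1 =>
      obtain rfl : s = m + k := by omega
      have h1 := ih m (k + 1) (by omega)
      have h2 := ih (m + 1) k (by omega)
      rw [show m + 1 + 2 * (k + 1) = m + 1 + 2 * k + 2 by ring, lucasCoeff,
        show m + 1 + 2 * k + 1 = m + 2 * (k + 1) by ring, Nat.factorial_succ (m + k)]
      rw [Nat.factorial_succ] at h1 h2
      rw [Nat.factorial_succ, Nat.factorial_succ]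
      linear_combination (m + 1) * h1 + (k + 1) * h2

/-- A Pochhammer analogue of the Girard–Waring formula for `x ^ n + y ^ n`. -/
lemma sum_lucasCoeff_poch (n : ℕ) : ∀ (x y : ℝ) (N : ℕ), n < 2 * N →
    ∑ k ∈ Finset.range N, (-1) ^ k * (lucasCoeff n k : ℝ) * (poch x k * poch y k) *
      poch (x + y + 2 * k) (n - 2 * k) = poch x n + poch y n := by
  induction n using Nat.twoStepInduction with
  | zero =>
    intro x y N hN
    obtain ⟨N, rfl⟩ : ∃ M, N = M + 1 := ⟨N - 1, by omega⟩
    rw [Finset.sum_range_succ']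
    norm_num [lucasCoeff, poch_zero]
  | one =>
    intro x y N hN
    obtain ⟨N, rfl⟩ : ∃ M, N = M + 1 := ⟨N - 1, by omega⟩
    rw [Finset.sum_range_succ']
    simp [lucasCoeff, poch]
  | more n ih₀ ih₁ =>
    intro x y N hN
    obtain ⟨N, rfl⟩ : ∃ M, N = M + 1 := ⟨N - 1, by omega⟩
    have h₀ := ih₀ (x + 1) (y + 1) N (by omega)
    have h₁ := ih₁ x y (N + 1) (by omega)
    have step (k : ℕ) : (lucasCoeff (n + 1) k : ℝ) * poch (x + y + 2 * k) (n + 2 - 2 * k) =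
        (x + y + n + 1) * (lucasCoeff (n + 1) k * poch (x + y + 2 * k) (n + 1 - 2 * k)) := by
      rcases lt_or_ge (n + 1) (2 * k) with h | h
      · simp [lucasCoeff_eq_zero h]
      · rw [show n + 2 - 2 * k = n + 1 - 2 * k + 1 by omega, poch_succ, Nat.cast_sub h]
        push_cast
        ring
    have key : ∑ k ∈ Finset.range (N + 1), (-1) ^ k * (lucasCoeff (n + 2) k : ℝ) *
        (poch x k * poch y k) * poch (x + y + 2 * k) (n + 2 - 2 * k) =
        (x + y + n + 1) * (poch x (n + 1) + poch y (n + 1)) -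
          x * y * (poch (x + 1) n + poch (y + 1) n) := by
      rw [← h₀, ← h₁, Finset.sum_range_succ', Finset.sum_range_succ', mul_add, Finset.mul_sum,
        Finset.mul_sum, add_sub_right_comm, ← Finset.sum_sub_distrib]
      congr 1
      · refine Finset.sum_congr rfl fun k _ => ?_
        have e := step (k + 1)
        rw [lucasCoeff, poch_succ' x, poch_succ' y]
        rw [show n + 2 - 2 * (k + 1) = n - 2 * k by omega] at e ⊢
        rw [show x + 1 + (y + 1) + 2 * (k : ℝ) = x + y + 2 * ((k + 1 : ℕ) : ℝ) by push_cast; ring]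
        rw [Nat.cast_add]
        linear_combination
          (-1) ^ (k + 1) * (x * poch (x + 1) k * (y * poch (y + 1) k)) * e
      · have e := step 0
        rw [lucasCoeff_succ_zero] at e ⊢
        rw [lucasCoeff_succ_zero]
        linear_combination poch x 0 * poch y 0 * e
    rw [key, poch_succ x (n + 1), poch_succ y (n + 1)]
    push_cast
    linear_combination y * poch_succ' x n + x * poch_succ' y n

lemma hypergeometric_term_eq (m k s : ℕ) (hs : m + k = s + 1) (x y B : ℝ)
    (hB : poch B (m + 2 * k) ≠ 0) :
    (poch (-((m + 2 * k : ℕ) : ℝ) / 2) k * poch ((1 - ((m + 2 * k : ℕ) : ℝ)) / 2) k *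
        poch x k * poch y k) /
      ((Nat.factorial k : ℝ) * poch (1 - ((m + 2 * k : ℕ) : ℝ)) k * poch (B / 2) k *
        poch ((1 + B) / 2) k) =
    (-1) ^ k * (lucasCoeff (m + 2 * k) k : ℝ) * (poch x k * poch y k) *
      poch (B + 2 * k) m / poch B (m + 2 * k) := by
  have hsplit : poch B (m + 2 * k) = poch B (2 * k) * poch (B + 2 * k) m := by
    rw [add_comm m, poch_add]; push_cast; rfl
  have hnum := poch_neg_mul_factorial m (2 * k)
  rw [show -((m : ℝ) + (2 * k : ℕ)) = -((m + 2 * k : ℕ) : ℝ) by push_cast; ring, poch_two_mul,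
    ← sub_eq_add_neg, pow_mul, neg_one_sq, one_pow, one_mul] at hnum
  have hden := poch_neg_mul_factorial s k
  have hs' : (m : ℝ) + k = s + 1 := by exact_mod_cast hs
  rw [show -((s : ℝ) + k) = 1 - ((m + 2 * k : ℕ) : ℝ) by push_cast; linear_combination hs'] at hden
  have hc : (lucasCoeff (m + 2 * k) k : ℝ) * (k.factorial * m.factorial) =
      (m + 2 * k : ℕ) * s.factorial := by
    exact_mod_cast lucasCoeff_mul_factorial s m k hs
  have hfac : ((m + 2 * k).factorial : ℝ) = (m + 2 * k : ℕ) * ((s + k).factorial : ℝ) := by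
    rw [show m + 2 * k = s + k + 1 by omega, Nat.factorial_succ]
    push_cast; ring
  rw [hfac] at hnum
  rw [hsplit] at hB ⊢
  have hB2 := right_ne_zero_of_mul hB
  have hB1 := left_ne_zero_of_mul hB
  rw [poch_two_mul] at hB1 ⊢
  have hP := right_ne_zero_of_mul hB1
  have hP1 := left_ne_zero_of_mul hP
  have hP2 := right_ne_zero_of_mul hP
  have hk : (k.factorial : ℝ) ≠ 0 := by positivity
  have hm : (m.factorial : ℝ) ≠ 0 := by positivity
  have hsf : (s.factorial : ℝ) ≠ 0 := by positivity
  have hsk : ((s + k).factorial : ℝ) ≠ 0 := by positivity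
  have hsgn : ((-1 : ℝ) ^ k) * (-1) ^ k = 1 := by rw [← mul_pow]; norm_num
  have hd : poch (1 - ((m + 2 * k : ℕ) : ℝ)) k ≠ 0 := by
    intro h
    rw [h, zero_mul] at hden
    exact mul_ne_zero (pow_ne_zero k (by norm_num)) hsk hden.symm
  have main : 4 ^ k * (poch (-((m + 2 * k : ℕ) : ℝ) / 2) k *
      poch ((1 - ((m + 2 * k : ℕ) : ℝ)) / 2) k) =
      (-1) ^ k * (lucasCoeff (m + 2 * k) k : ℝ) *
        (k.factorial * poch (1 - ((m + 2 * k : ℕ) : ℝ)) k) := by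
    apply mul_right_cancel₀ (mul_ne_zero hm hsf)
    linear_combination s.factorial * hnum -
      (-1) ^ k * (lucasCoeff (m + 2 * k) k : ℝ) * k.factorial * m.factorial * hden -
      (-1) ^ k * (-1) ^ k * ((s + k).factorial : ℝ) * hc -
      ((m + 2 * k : ℕ) : ℝ) * s.factorial * (s + k).factorial * hsgn
  generalize poch (-((m + 2 * k : ℕ) : ℝ) / 2) k = p at *
  generalize poch ((1 - ((m + 2 * k : ℕ) : ℝ)) / 2) k = q at *
  rw [div_eq_div_iff (by positivity) (by positivity)]
  linear_combination poch x k * poch y k * poch (B / 2) k * poch ((1 + B) / 2) k *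
    poch (B + 2 * k) m * main

/-- Lemma A3: a terminating ₄F₃ summation. -/
theorem lemA3 (n : ℕ) (hn : 0 < n) (A B : ℝ) (hB : poch B n ≠ 0) :
    ∑ k ∈ Finset.range (n / 2 + 1),
      (poch (-(n : ℝ) / 2) k * poch ((1 - (n : ℝ)) / 2) k * poch (-A) k * poch (A + B) k) /
        ((Nat.factorial k : ℝ) * poch (1 - (n : ℝ)) k * poch (B / 2) k *
          poch ((1 + B) / 2) k) =
      poch (A + B) n / poch B n + poch (-A) n / poch B n := by
  rw [← add_div, add_comm (poch (A + B) n),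
    ← sum_lucasCoeff_poch n (-A) (A + B) (n / 2 + 1) (by omega), Finset.sum_div]
  refine Finset.sum_congr rfl fun k hk => ?_
  rw [Finset.mem_range] at hk
  obtain ⟨m, rfl⟩ : ∃ m, n = m + 2 * k := ⟨n - 2 * k, by omega⟩
  rw [hypergeometric_term_eq m k (m + k - 1) (by omega) _ _ B hB, Nat.add_sub_cancel,
    neg_add_cancel_left]
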